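/- arXiv:1707.04806 — 6 statements merged into one kernel-verified Lean document; each statement's English description precedes it below -/
import Mathlib

section
/- Let n ≥ 3 and let E be a real symmetric n×n matrix with trace zero. Then |∑_{i,j,k} E_{ij} E_{jk} E_{ki}| ≤ ((n−2)/√(n(n−1))) · ‖E‖³, where ‖E‖ = √(∑_{i,j} E_{ij}²) is the Frobenius norm. -/
open Finset

/-- The scalar upper bound. -/
lemma okumura_scalar (n : ℕ) (hn : 3 ≤ n) (x : Fin n → ℝ) (S : ℝ) (hS : 0 ≤ S)
    (h1 : ∑ i, x i = 0) (h2 : ∑ i, x i ^ 2 = S ^ 2) :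
    ∑ i, x i ^ 3 ≤ (((n : ℝ) - 2) / Real.sqrt ((n : ℝ) * ((n : ℝ) - 1))) * S ^ 3 := by
  have hn' : (3 : ℝ) ≤ n := by exact_mod_cast hn
  have hpos : 0 < (n : ℝ) * ((n : ℝ) - 1) := by nlinarith
  set r := Real.sqrt ((n : ℝ) * ((n : ℝ) - 1)) with hr
  have hr0 : 0 < r := Real.sqrt_pos.mpr hpos
  have hr2 : r ^ 2 = (n : ℝ) * ((n : ℝ) - 1) := Real.sq_sqrt hpos.le
  have hb : ∀ i, x i ≤ ((n : ℝ) - 1) * (S / r) := by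
    intro i
    have hc := sq_sum_le_card_mul_sum_sq (s := univ.erase i) (f := x)
    have e1 := Finset.add_sum_erase univ x (mem_univ i)
    have e2 := Finset.add_sum_erase univ (fun j => x j ^ 2) (mem_univ i)
    have ecard : (((univ.erase i).card : ℕ) : ℝ) = (n : ℝ) - 1 := by
      rw [card_erase_of_mem (mem_univ i), card_univ, Fintype.card_fin,
        Nat.cast_sub (by omega)]
      simp
    have e3 : ∑ j ∈ univ.erase i, x j = - x i := by linarith
    have e4 : ∑ j ∈ univ.erase i, x j ^ 2 = S ^ 2 - x i ^ 2 := by linarith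
    rw [ecard, e3, e4] at hc
    have hnn : 0 ≤ ((n : ℝ) - 1) * (S / r) :=
      mul_nonneg (by linarith) (div_nonneg hS hr0.le)
    refine (abs_le_of_sq_le_sq' ?_ hnn).2
    rw [mul_pow, div_pow, hr2, ← mul_div_assoc, le_div_iff₀ hpos]
    nlinarith
  have hsum : 0 ≤ ∑ i, (((n : ℝ) - 1) * (S / r) - x i) * (x i + S / r) ^ 2 :=
    Finset.sum_nonneg fun i _ => mul_nonneg (sub_nonneg.mpr (hb i)) (sq_nonneg _)
  set a := S / r with ha
  have hS' : S = a * r := by rw [ha]; field_simp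
  have hexp : ∑ i, (((n : ℝ) - 1) * a - x i) * (x i + a) ^ 2
      = (((n : ℝ) - 1) * a - 2 * a) * ∑ i, x i ^ 2
        + (2 * a * (((n : ℝ) - 1) * a) - a ^ 2) * ∑ i, x i
        + n * (((n : ℝ) - 1) * a * a ^ 2) - ∑ i, x i ^ 3 := by
    have hconst : (n : ℝ) * (((n : ℝ) - 1) * a * a ^ 2)
        = ∑ _i : Fin n, (((n : ℝ) - 1) * a * a ^ 2) := by simp
    rw [hconst, Finset.mul_sum, Finset.mul_sum, ← Finset.sum_add_distrib,
      ← Finset.sum_add_distrib, ← Finset.sum_sub_distrib]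
    exact Finset.sum_congr rfl fun i _ => by ring
  rw [hexp, h1, h2] at hsum
  have hR : ((n : ℝ) - 2) / r * S ^ 3 = ((n : ℝ) - 2) * a * S ^ 2 := by rw [ha]; ring
  have hlast : (n : ℝ) * (((n : ℝ) - 1) * a * a ^ 2) = a * S ^ 2 := by
    rw [hS', mul_pow, hr2]; ring
  rw [hR]
  linarith

lemma trace_pow_eigen (n : ℕ) (E : Matrix (Fin n) (Fin n) ℝ) (hE : E.IsHermitian) (k : ℕ) :
    (E ^ k).trace = ∑ i, hE.eigenvalues i ^ k := by
  conv_lhs => rw [hE.spectral_theorem]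
  rw [← map_pow, Unitary.conjStarAlgAut_apply, Matrix.trace_mul_comm, ← mul_assoc,
    Unitary.coe_star_mul_self, one_mul, Matrix.diagonal_pow, Matrix.trace_diagonal]
  simp

/-- Okumura's inequality: for a real symmetric trace-free `n × n` matrix `E` (`n ≥ 3`),
`|tr E³| ≤ ((n-2)/√(n(n-1))) ‖E‖³` where `‖E‖` is the Frobenius norm. -/
theorem okumura_inequality (n : ℕ) (hn : 3 ≤ n) (E : Matrix (Fin n) (Fin n) ℝ)
    (hsymm : ∀ i j, E i j = E j i) (htrace : ∑ i, E i i = 0) :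
    |∑ i, ∑ j, ∑ k, E i j * E j k * E k i| ≤
      (((n : ℝ) - 2) / Real.sqrt ((n : ℝ) * ((n : ℝ) - 1))) *
        (Real.sqrt (∑ i, ∑ j, (E i j) ^ 2)) ^ 3 := by
  have hE : E.IsHermitian := by
    ext i j
    simp [Matrix.conjTranspose_apply, hsymm i j]
  have t1 : ∑ i, hE.eigenvalues i = 0 := by
    have := trace_pow_eigen n E hE 1
    simp only [pow_one] at this
    rw [← this, ← htrace]
    rfl
  have t2 : ∑ i, ∑ j, (E i j) ^ 2 = ∑ i, hE.eigenvalues i ^ 2 := by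
    rw [← trace_pow_eigen n E hE 2, pow_two, Matrix.trace]
    refine Finset.sum_congr rfl fun i _ => ?_
    rw [Matrix.diag_apply, Matrix.mul_apply]
    exact Finset.sum_congr rfl fun j _ => by rw [hsymm j i, pow_two]
  have t3 : ∑ i, ∑ j, ∑ k, E i j * E j k * E k i = ∑ i, hE.eigenvalues i ^ 3 := by
    rw [← trace_pow_eigen n E hE 3, pow_succ', pow_two, Matrix.trace]
    refine Finset.sum_congr rfl fun i _ => ?_
    rw [Matrix.diag_apply, Matrix.mul_apply]
    refine Finset.sum_congr rfl fun j _ => ?_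
    rw [Matrix.mul_apply, Finset.mul_sum]
    exact Finset.sum_congr rfl fun k _ => by ring
  have hS2 : ∑ i, hE.eigenvalues i ^ 2 = Real.sqrt (∑ i, ∑ j, (E i j) ^ 2) ^ 2 := by
    rw [t2, Real.sq_sqrt (Finset.sum_nonneg fun i _ => sq_nonneg _)]
  rw [t3, abs_le']
  refine ⟨okumura_scalar n hn _ _ (Real.sqrt_nonneg _) t1 hS2, ?_⟩
  have := okumura_scalar n hn (fun i => - hE.eigenvalues i) _ (Real.sqrt_nonneg _)
    (by rw [Finset.sum_neg_distrib, t1, neg_zero]) (by simpa using hS2)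
  refine le_trans (le_of_eq ?_) this
  rw [← Finset.sum_neg_distrib]
  exact Finset.sum_congr rfl fun i _ => by ring
end

section
/- Let n ≥ 3 and let E be a real symmetric n×n matrix with trace zero. Then |∑_{i,j,k} E_{ij} E_{jk} E_{ki}| = ((n−2)/√(n(n−1))) · ‖E‖³ holds if and only if E has an eigenvalue of multiplicity at least n−1 (equivalently, E is orthogonally diagonalizable with at least n−1 of its eigenvalues equal). -/
open Finset

lemma oku_bound {n : ℕ} (hn : 3 ≤ n) (x : Fin n → ℝ) (t : ℝ) (ht : 0 ≤ t)
    (h1 : ∑ i, x i = 0) (h2 : ∑ i, x i ^ 2 = n * (n - 1) * t ^ 2) (i : Fin n) :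
    x i ≤ (n - 1) * t := by
  have hn' : (3 : ℝ) ≤ n := by exact_mod_cast hn
  have hm : (0 : ℝ) < n - 1 := by linarith
  have key : ((n - 1) * x i + x i) ^ 2 ≤ ∑ k, ((n - 1) * x k + x i) ^ 2 :=
    Finset.single_le_sum (f := fun k => ((n - 1 : ℝ) * x k + x i) ^ 2)
      (fun k _ => sq_nonneg _) (Finset.mem_univ i)
  have e : ∑ k, ((n - 1 : ℝ) * x k + x i) ^ 2 =
      (n - 1) ^ 2 * ∑ k, x k ^ 2 + 2 * (n - 1) * x i * ∑ k, x k + n * x i ^ 2 := by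
    simp only [add_sq, mul_pow, Finset.sum_add_distrib, Finset.mul_sum]
    simp
    exact Finset.sum_congr rfl (fun k _ => by ring)
  rw [e, h1, h2] at key
  have h3 : (n * (n - 1) : ℝ) * x i ^ 2 ≤ (n * (n - 1)) * ((n - 1) * t) ^ 2 := by
    nlinarith
  have h4 : x i ^ 2 ≤ ((n - 1) * t) ^ 2 := le_of_mul_le_mul_left h3 (by positivity)
  exact le_of_sq_le_sq h4 (by positivity)

lemma oku_eq {n : ℕ} (hn : 3 ≤ n) (x : Fin n → ℝ) (t : ℝ) (ht : 0 ≤ t)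
    (h1 : ∑ i, x i = 0) (h2 : ∑ i, x i ^ 2 = n * (n - 1) * t ^ 2)
    (h3 : ∑ i, x i ^ 3 = n * (n - 1) * (n - 2) * t ^ 3) :
    n - 1 ≤ (Finset.univ.filter (fun i => x i = -t)).card := by
  have hn' : (3 : ℝ) ≤ n := by exact_mod_cast hn
  have hm : (0 : ℝ) < n - 1 := by linarith
  have e : ∑ i, ((n - 1) * t - x i) * (x i + t) ^ 2 = 0 := by
    have : ∀ i, ((n - 1) * t - x i) * (x i + t) ^ 2 =
      - x i ^ 3 + (n - 3) * t * x i ^ 2 + (2 * (n - 1) - 1) * t ^ 2 * x i + (n - 1) * t ^ 3 := by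
      intro i; ring
    simp only [this, Finset.sum_add_distrib, ← Finset.mul_sum, Finset.sum_neg_distrib, h1, h2, h3]
    simp
    ring
  rw [Finset.sum_eq_zero_iff_of_nonneg (fun i _ => mul_nonneg
    (sub_nonneg.2 (oku_bound hn x t ht h1 h2 i)) (sq_nonneg _))] at e
  have hc : (Finset.univ.filter (fun i => ¬ x i = -t)).card ≤ 1 := by
    rw [Finset.card_le_one]
    intro a ha b hb
    by_contra hab
    simp only [Finset.mem_filter, Finset.mem_univ, true_and] at ha hb
    have ev : ∀ a, ¬ x a = -t → x a = (n - 1) * t := by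
      intro a ha
      rcases mul_eq_zero.1 (e a (Finset.mem_univ a)) with h | h
      · linarith
      · exact absurd (by linarith [pow_eq_zero_iff (two_ne_zero) |>.1 h]) ha
    have hva := ev a ha
    have hvb := ev b hb
    have htp : 0 < t := by
      rcases ht.lt_or_eq with h | h
      · exact h
      · subst h; simp at ha hva; exact absurd hva ha
    have hs : ∑ i ∈ {a, b}, x i ^ 2 ≤ ∑ i, x i ^ 2 :=
      Finset.sum_le_sum_of_subset_of_nonneg (Finset.subset_univ _) (fun _ _ _ => sq_nonneg _)
    rw [Finset.sum_pair hab, hva, hvb, h2] at hs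
    have : 0 < (n - 1) * t ^ 2 * ((n : ℝ) - 2) :=
      mul_pos (by positivity) (by linarith)
    nlinarith
  have := Finset.card_filter_add_card_filter_not (s := (Finset.univ : Finset (Fin n))) (fun i => x i = -t)
  simp only [Finset.card_univ, Fintype.card_fin] at this
  omega

lemma oku_real {n : ℕ} (hn : 3 ≤ n) (x : Fin n → ℝ) (t : ℝ) (ht : 0 ≤ t)
    (h1 : ∑ i, x i = 0) (h2 : ∑ i, x i ^ 2 = n * (n - 1) * t ^ 2) :
    |∑ i, x i ^ 3| = n * (n - 1) * (n - 2) * t ^ 3 ↔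
    ∃ μ : ℝ, n - 1 ≤ (Finset.univ.filter (fun i => x i = μ)).card := by
  have hn' : (3 : ℝ) ≤ n := by exact_mod_cast hn
  have hm : (0 : ℝ) < n - 1 := by linarith
  have hm2 : (0 : ℝ) < n - 2 := by linarith
  constructor
  · intro h
    rcases abs_choice (∑ i, x i ^ 3) with h' | h'
    · exact ⟨-t, oku_eq hn x t ht h1 h2 (by rw [← h, h'])⟩
    · refine ⟨t, ?_⟩
      have := oku_eq hn (fun i => - x i) t ht (by simp [h1]) (by simpa using h2)
        (by rw [← h, h', ← Finset.sum_neg_distrib]; exact Finset.sum_congr rfl fun i _ => by ring)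
      simpa using this
  · rintro ⟨μ, h⟩
    have hj : ∃ j, ∀ i, i ≠ j → x i = μ := by
      have := Finset.card_filter_add_card_filter_not (s := (Finset.univ : Finset (Fin n)))
        (fun i => x i = μ)
      simp only [Finset.card_univ, Fintype.card_fin] at this
      have hc : (Finset.univ.filter (fun i => ¬ x i = μ)).card ≤ 1 := by omega
      haveI : Nonempty (Fin n) := ⟨⟨0, by omega⟩⟩
      obtain ⟨j, hj⟩ := Finset.card_le_one_iff_subset_singleton.1 hc
      refine ⟨j, fun i hi => ?_⟩
      by_contra hx
      exact hi (Finset.mem_singleton.1 (hj (by simp [hx])))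
    obtain ⟨j, hj⟩ := hj
    have hsum : ∀ p : ℕ, ∑ i, x i ^ p = x j ^ p + (n - 1) * μ ^ p := by
      intro p
      rw [← Finset.add_sum_erase _ _ (Finset.mem_univ j)]
      congr 1
      rw [Finset.sum_congr rfl (g := fun _ => μ ^ p)
        (fun i hi => by rw [hj i (Finset.ne_of_mem_erase hi)])]
      rw [Finset.sum_const, Finset.card_erase_of_mem (Finset.mem_univ j)]
      simp [Nat.cast_sub (show 1 ≤ n by omega)]
    have e1 := hsum 1
    simp only [pow_one, h1] at e1
    have hxj : x j = -(n - 1) * μ := by linarith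
    have e2 := hsum 2
    rw [h2, hxj] at e2
    have ht2 : t ^ 2 = μ ^ 2 := by
      have : (n * (n - 1) : ℝ) * t ^ 2 = (n * (n - 1)) * μ ^ 2 := by rw [e2]; ring
      exact mul_left_cancel₀ (by positivity) this
    have htm : t = |μ| := by rw [← abs_of_nonneg ht]; exact sq_eq_sq_iff_abs_eq_abs _ _ |>.1 ht2
    rw [hsum 3, hxj, htm]
    have : (-((n : ℝ) - 1) * μ) ^ 3 + (n - 1) * μ ^ 3 = -((n * (n - 1) * (n - 2)) * μ ^ 3) := by ring
    rw [this, abs_neg, abs_mul, abs_pow, abs_of_nonneg (by positivity)]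

lemma oku_trace {n : ℕ} (E : Matrix (Fin n) (Fin n) ℝ) (hE : E.IsHermitian) (p : ℕ) :
    (E ^ p).trace = ∑ i, hE.eigenvalues i ^ p := by
  conv_lhs => rw [hE.spectral_theorem]
  rw [← map_pow, Matrix.diagonal_pow, Unitary.conjStarAlgAut_apply, Matrix.trace_mul_cycle]
  simp [Matrix.trace_diagonal]

/-- Equality characterization of Okumura's inequality: for a real symmetric trace-free
`n × n` matrix `E` (`n ≥ 3`), `|tr E³| = ((n-2)/√(n(n-1))) ‖E‖³` holds iff `E` has an
eigenvalue of multiplicity at least `n - 1`. -/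
theorem okumura_equality_iff (n : ℕ) (hn : 3 ≤ n) (E : Matrix (Fin n) (Fin n) ℝ)
    (hE : E.IsHermitian) (htrace : ∑ i, E i i = 0) :
    |∑ i, ∑ j, ∑ k, E i j * E j k * E k i| =
      (((n : ℝ) - 2) / Real.sqrt ((n : ℝ) * ((n : ℝ) - 1))) *
        (Real.sqrt (∑ i, ∑ j, (E i j) ^ 2)) ^ 3 ↔
    ∃ μ : ℝ, n - 1 ≤ (Finset.univ.filter (fun i => hE.eigenvalues i = μ)).card := by
  have hn' : (3 : ℝ) ≤ n := by exact_mod_cast hn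
  have hm : (0 : ℝ) < n - 1 := by linarith
  have t1 : ∑ i, hE.eigenvalues i = 0 := by
    have := oku_trace E hE 1
    simp only [pow_one] at this
    rw [← this]; exact htrace
  have t2 : ∑ i, ∑ j, (E i j) ^ 2 = ∑ i, hE.eigenvalues i ^ 2 := by
    rw [← oku_trace E hE 2, pow_two, Matrix.trace]
    refine Finset.sum_congr rfl fun i _ => ?_
    rw [Matrix.diag_apply, Matrix.mul_apply]
    refine Finset.sum_congr rfl fun j _ => ?_
    have := hE.apply i j
    simp only [star_trivial] at this
    rw [this, pow_two]
  have t3 : ∑ i, ∑ j, ∑ k, E i j * E j k * E k i = ∑ i, hE.eigenvalues i ^ 3 := by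
    rw [← oku_trace E hE 3, pow_succ, pow_two, mul_assoc, Matrix.trace]
    refine Finset.sum_congr rfl fun i _ => ?_
    rw [Matrix.diag_apply, Matrix.mul_apply]
    refine Finset.sum_congr rfl fun j _ => ?_
    rw [Matrix.mul_apply, Finset.mul_sum]
    exact Finset.sum_congr rfl fun k _ => by ring
  rw [t2, t3]
  set S := ∑ i, hE.eigenvalues i ^ 2 with hS
  have hS0 : 0 ≤ S := Finset.sum_nonneg fun i _ => sq_nonneg _
  have hr : 0 < Real.sqrt ((n : ℝ) * ((n : ℝ) - 1)) := Real.sqrt_pos.2 (by positivity)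
  have hr2 := Real.sq_sqrt (show 0 ≤ (n : ℝ) * ((n : ℝ) - 1) by positivity)
  have hs2 := Real.sq_sqrt hS0
  set r := Real.sqrt ((n : ℝ) * ((n : ℝ) - 1))
  set s := Real.sqrt S
  have hs : 0 ≤ s := Real.sqrt_nonneg _
  have := oku_real hn hE.eigenvalues (s / r) (by positivity) t1
    (by rw [← hS, ← hr2, ← hs2]; field_simp)
  rw [← this]
  have e : (n : ℝ) * (n - 1) * (n - 2) * (s / r) ^ 3 = (n - 2) / r * s ^ 3 := by
    rw [← hr2]; field_simp
  rw [e]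
end

section
/- Let n ≥ 3 and let E be a nonzero real symmetric n×n matrix with trace zero. If ∑_{i,j,k} E_{ij} E_{jk} E_{ki} = −((n−2)/√(n(n−1))) · ‖E‖³, then there exists λ > 0 such that E has eigenvalue λ with multiplicity n−1 and eigenvalue −(n−1)λ with multiplicity 1. -/
open Finset

theorem okumura_trace_pow {n : ℕ} (E : Matrix (Fin n) (Fin n) ℝ) (hE : E.IsHermitian) (k : ℕ) :
    (E ^ k).trace = ∑ i, hE.eigenvalues i ^ k := by
  conv_lhs => rw [hE.spectral_theorem, ← map_pow, Unitary.conjStarAlgAut_apply]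
  rw [Matrix.trace_mul_comm, ← mul_assoc, Unitary.coe_star_mul_self, one_mul,
    Matrix.diagonal_pow, Matrix.trace_diagonal]
  simp

theorem okumura_aux {n : ℕ} (hn : 3 ≤ n) (a : Fin n → ℝ) (r : ℝ) (hr : 0 < r)
    (h1 : ∑ i, a i = 0) (h2 : ∑ i, a i ^ 2 = n * (n - 1) * r ^ 2)
    (h3 : ∑ i, a i ^ 3 = -((n - 2) * (n * (n - 1) * r ^ 3))) :
    (Finset.univ.filter (fun i => a i = r)).card = n - 1 ∧
      (Finset.univ.filter (fun i => a i = -((n : ℝ) - 1) * r)).card = 1 := by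
  have hn' : (3 : ℝ) ≤ n := by exact_mod_cast hn
  have hlow : ∀ i, 0 ≤ a i + (n - 1) * r := by
    intro i
    have hs := Finset.add_sum_erase Finset.univ a (Finset.mem_univ i)
    have hs2 := Finset.add_sum_erase Finset.univ (fun i => a i ^ 2) (Finset.mem_univ i)
    have hc := sq_sum_le_card_mul_sum_sq (s := Finset.univ.erase i) (f := a)
    rw [Finset.card_erase_of_mem (Finset.mem_univ i), Finset.card_univ, Fintype.card_fin,
      Nat.cast_sub (by omega), Nat.cast_one] at hc
    rw [h1] at hs
    rw [h2] at hs2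
    have e1 : ∑ x ∈ Finset.univ.erase i, a x = - a i := by linarith
    have e2 : ∑ x ∈ Finset.univ.erase i, a x ^ 2 = n * (n - 1) * r ^ 2 - a i ^ 2 := by linarith
    rw [e1, e2] at hc
    have h4 : (n : ℝ) * a i ^ 2 ≤ n * ((n - 1) * r) ^ 2 := by nlinarith
    have h5 : a i ^ 2 ≤ ((n - 1) * r) ^ 2 := le_of_mul_le_mul_left h4 (by linarith)
    have h6 := abs_le_of_sq_le_sq h5 (mul_nonneg (by linarith) hr.le)
    linarith [(abs_le.1 h6).1]
  have hsum : ∑ i, (a i - r) ^ 2 * (a i + (n - 1) * r) = 0 := by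
    have : ∀ i, (a i - r) ^ 2 * (a i + (n - 1) * r) =
        a i ^ 3 + (n - 3) * r * a i ^ 2 + (r ^ 2 - 2 * r * ((n - 1) * r)) * a i
          + (n - 1) * r ^ 3 := by intro i; ring
    simp only [this, Finset.sum_add_distrib, ← Finset.mul_sum, h1, h2, h3]
    simp
    ring
  have hz := (Finset.sum_eq_zero_iff_of_nonneg
    (fun i _ => mul_nonneg (sq_nonneg (a i - r)) (hlow i))).1 hsum
  have hor : ∀ i, a i = r ∨ a i = -((n : ℝ) - 1) * r := by
    intro i
    rcases mul_eq_zero.1 (hz i (Finset.mem_univ i)) with h | h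
    · left; have := pow_eq_zero_iff (two_ne_zero) |>.1 h; linarith
    · right; linarith
  have hdist : -((n : ℝ) - 1) * r ≠ r := by nlinarith
  have hfe : (Finset.univ.filter (fun i => a i = -((n : ℝ) - 1) * r)) =
      Finset.univ.filter (fun i => ¬ a i = r) := by
    ext i
    simp only [Finset.mem_filter, Finset.mem_univ, true_and]
    constructor
    · intro h; rw [h]; exact hdist
    · intro h; exact (hor i).resolve_left h
  have hcard := Finset.card_filter_add_card_filter_not (s := (Finset.univ : Finset (Fin n)))
    (fun i => a i = r)
  rw [Finset.card_univ, Fintype.card_fin] at hcard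
  have hval : ∀ i, a i = r - (if ¬ a i = r then n * r else 0) := by
    intro i
    split_ifs with h
    · linarith
    · rw [(hor i).resolve_left h]; ring
  have hm : ((Finset.univ.filter (fun i => ¬ a i = r)).card : ℝ) = 1 := by
    have h7 : ∑ i, a i = ∑ i, (r - (if ¬ a i = r then n * r else 0)) :=
      Finset.sum_congr rfl (fun i _ => hval i)
    rw [h1, Finset.sum_sub_distrib, ← Finset.sum_filter, Finset.sum_const, Finset.sum_const,
      Finset.card_univ, Fintype.card_fin, nsmul_eq_mul, nsmul_eq_mul] at h7
    have h8 : (n : ℝ) * r ≠ 0 := by positivity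
    apply mul_right_cancel₀ h8
    linarith
  have hm' : (Finset.univ.filter (fun i => ¬ a i = r)).card = 1 := by exact_mod_cast hm
  rw [hfe]
  exact ⟨by omega, hm'⟩

/-- If a nonzero real symmetric trace-free matrix `E` achieves equality on the negative
side of Okumura's inequality, i.e. `tr E³ = -((n-2)/√(n(n-1))) ‖E‖³`, then `E` has a
positive eigenvalue `λ` of multiplicity `n - 1` and the eigenvalue `-(n-1)λ` of
multiplicity `1`. -/
theorem okumura_negative_equality (n : ℕ) (hn : 3 ≤ n) (E : Matrix (Fin n) (Fin n) ℝ)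
    (hE : E.IsHermitian) (htrace : ∑ i, E i i = 0) (hne : E ≠ 0)
    (heq : ∑ i, ∑ j, ∑ k, E i j * E j k * E k i =
      -((((n : ℝ) - 2) / Real.sqrt ((n : ℝ) * ((n : ℝ) - 1))) *
        (Real.sqrt (∑ i, ∑ j, (E i j) ^ 2)) ^ 3)) :
    ∃ lam : ℝ, 0 < lam ∧
      (Finset.univ.filter (fun i => hE.eigenvalues i = lam)).card = n - 1 ∧
      (Finset.univ.filter (fun i => hE.eigenvalues i = -((n : ℝ) - 1) * lam)).card = 1 := by
  have hn' : (3 : ℝ) ≤ n := by exact_mod_cast hn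
  have hsym : ∀ i j, E j i = E i j := fun i j => by simpa using hE.apply i j
  have t1 : ∑ i, hE.eigenvalues i = 0 := by
    have := okumura_trace_pow E hE 1
    simp only [pow_one, Matrix.trace, Matrix.diag_apply] at this
    rw [← this, htrace]
  have t2 : ∑ i, hE.eigenvalues i ^ 2 = ∑ i, ∑ j, (E i j) ^ 2 := by
    rw [← okumura_trace_pow E hE 2]
    simp only [pow_two, Matrix.trace, Matrix.diag_apply, Matrix.mul_apply]
    exact Finset.sum_congr rfl fun i _ => Finset.sum_congr rfl fun j _ => by rw [hsym i j]
  have t3 : ∑ i, hE.eigenvalues i ^ 3 = ∑ i, ∑ j, ∑ k, E i j * E j k * E k i := by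
    rw [← okumura_trace_pow E hE 3, pow_succ, pow_two, mul_assoc]
    simp only [Matrix.trace, Matrix.diag_apply, Matrix.mul_apply, Finset.mul_sum, mul_assoc]
  have hpos : 0 < ∑ i, ∑ j, (E i j) ^ 2 := by
    have : ∃ i j, E i j ≠ 0 := by
      by_contra! h
      exact hne (Matrix.ext h)
    obtain ⟨i, j, hij⟩ := this
    refine Finset.sum_pos' (fun i _ => Finset.sum_nonneg fun j _ => sq_nonneg _)
      ⟨i, Finset.mem_univ i, Finset.sum_pos' (fun j _ => sq_nonneg _)
        ⟨j, Finset.mem_univ j, by positivity⟩⟩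
  rw [heq] at t3
  set S := ∑ i, ∑ j, (E i j) ^ 2 with hS
  have hN : 0 < (n : ℝ) * (n - 1) := mul_pos (by linarith) (by linarith)
  have hq := Real.sqrt_pos.2 hN
  have hq2 := Real.sq_sqrt hN.le
  have hs := Real.sqrt_pos.2 hpos
  have hs2 := Real.sq_sqrt hpos.le
  refine ⟨√S / √((n : ℝ) * (n - 1)), div_pos hs hq,
    okumura_aux hn _ _ (div_pos hs hq) t1 ?_ ?_⟩
  · rw [t2, div_pow, hq2, hs2, mul_div_cancel₀ _ hN.ne']
  · rw [t3]
    generalize √((n : ℝ) * (n - 1)) = q at *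
    rw [← hq2]
    field_simp
end

section
/- Let n ≥ 3, let W : (Fin n)⁴ → ℝ satisfy W_{ijkl} = −W_{jikl}, W_{ijkl} = −W_{ijlk}, W_{ijkl} = W_{klij}, the first Bianchi identity W_{ijkl} + W_{iklj} + W_{iljk} = 0, and be totally trace-free (∑_i W_{ijil} = 0 for all j, l), and let E be a real symmetric n×n matrix with trace zero. Then |∑_{i,j,k,l} W_{ikjl} E_{ij} E_{kl}| ≤ √((n−2)/(2(n−1))) · ‖W‖ · ‖E‖², where ‖W‖ = √(∑_{i,j,k,l} W_{ijkl}²) and ‖E‖ = √(∑_{i,j} E_{ij}²). -/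
open Finset

/-- The antisymmetrized product of two matrices. -/
def hkK {n : ℕ} (B C : Matrix (Fin n) (Fin n) ℝ) (i j k l : Fin n) : ℝ :=
  B i j * C k l - B i l * C k j

lemma hk_direct {n : ℕ} (B C B' C' : Matrix (Fin n) (Fin n) ℝ) (hB : B'.transpose = B')
    (hC : C'.transpose = C') :
    ∑ i, ∑ j, ∑ k, ∑ l, (B i j * C k l) * (B' i j * C' k l)
      = (B * B').trace * (C * C').trace := by
  have h1 : ∀ M N : Matrix (Fin n) (Fin n) ℝ, N.transpose = N →
      (M * N).trace = ∑ i, ∑ j, M i j * N i j := by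
    intro M N h
    simp only [Matrix.trace, Matrix.diag, Matrix.mul_apply]
    refine sum_congr rfl fun i _ => sum_congr rfl fun j _ => ?_
    rw [← congrFun (congrFun h i) j, Matrix.transpose_apply]
  rw [h1 _ _ hB, h1 _ _ hC, mul_comm]
  simp only [Finset.sum_mul, Finset.mul_sum]
  refine sum_congr rfl fun i _ => sum_congr rfl fun j _ => sum_congr rfl fun k _ =>
    sum_congr rfl fun l _ => ?_
  ring

lemma hk_cross {n : ℕ} (B C B' C' : Matrix (Fin n) (Fin n) ℝ) (hB : B'.transpose = B')
    (hC : C'.transpose = C') :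
    ∑ i, ∑ j, ∑ k, ∑ l, (B i j * C k l) * (B' i l * C' k j)
      = (B * (C' * (C * B'))).trace := by
  simp only [Matrix.trace, Matrix.diag, Matrix.mul_apply, Finset.mul_sum]
  refine sum_congr rfl fun i _ => sum_congr rfl fun j _ => sum_congr rfl fun k _ =>
    sum_congr rfl fun l _ => ?_
  rw [← congrFun (congrFun hB i) l, ← congrFun (congrFun hC k) j, Matrix.transpose_apply,
    Matrix.transpose_apply]
  ring

lemma hk_swap {n : ℕ} (f : Fin n → Fin n → Fin n → Fin n → ℝ) :
    ∑ i, ∑ j, ∑ k, ∑ l, f i l k j = ∑ i, ∑ j, ∑ k, ∑ l, f i j k l := by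
  refine sum_congr rfl fun i _ => ?_
  rw [sum_comm]
  conv_rhs => rw [sum_comm]
  exact sum_congr rfl fun k _ => sum_comm

lemma hk_inner {n : ℕ} (B C B' C' : Matrix (Fin n) (Fin n) ℝ) (hB : B'.transpose = B')
    (hC : C'.transpose = C') :
    ∑ i, ∑ j, ∑ k, ∑ l, hkK B C i j k l * hkK B' C' i j k l
      = 2 * ((B * B').trace * (C * C').trace) - 2 * (B * (C' * (C * B'))).trace := by
  have e1 := hk_direct B C B' C' hB hC
  have e2 := hk_cross B C B' C' hB hC
  have e3 := hk_swap (fun i j k l => (B i j * C k l) * (B' i j * C' k l))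
  have e4 := hk_swap (fun i j k l => (B i j * C k l) * (B' i l * C' k j))
  have : ∀ i j k l, hkK B C i j k l * hkK B' C' i j k l =
      (B i j * C k l) * (B' i j * C' k l) + (B i l * C k j) * (B' i l * C' k j)
      - (B i j * C k l) * (B' i l * C' k j) - (B i l * C k j) * (B' i j * C' k l) := by
    intros; simp only [hkK]; ring
  simp only [this, sum_add_distrib, sum_sub_distrib]
  rw [e3, e4, e1, e2]; ring

lemma hk_norm {n : ℕ} (E A : Matrix (Fin n) (Fin n) ℝ) (hE : E.transpose = E)
    (hA : A.transpose = A) (ht : E.trace = 0) :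
    ∑ i, ∑ j, ∑ k, ∑ l, (hkK E E i j k l - hkK A 1 i j k l - hkK 1 A i j k l) ^ 2
      = 2 * (E * E).trace ^ 2 - 2 * (E * E * (E * E)).trace + 4 * (n - 2) * (A * A).trace
        + 8 * (E * E * A).trace + 4 * A.trace ^ 2 := by
  have h1 : (1 : Matrix (Fin n) (Fin n) ℝ).transpose = 1 := Matrix.transpose_one
  have a1 := hk_inner E E E E hE hE
  have a2 := hk_inner A 1 A 1 hA h1
  have a3 := hk_inner 1 A 1 A h1 hA
  have a4 := hk_inner E E A 1 hA h1
  have a5 := hk_inner E E 1 A h1 hA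
  have a6 := hk_inner A 1 1 A h1 hA
  have : ∀ i j k l, (hkK E E i j k l - hkK A 1 i j k l - hkK 1 A i j k l) ^ 2 =
      hkK E E i j k l * hkK E E i j k l + hkK A 1 i j k l * hkK A 1 i j k l
      + hkK 1 A i j k l * hkK 1 A i j k l
      - 2 * (hkK E E i j k l * hkK A 1 i j k l) - 2 * (hkK E E i j k l * hkK 1 A i j k l)
      + 2 * (hkK A 1 i j k l * hkK 1 A i j k l) := by
    intros; ring
  simp only [this, sum_add_distrib, sum_sub_distrib, ← Finset.mul_sum]
  rw [a1, a2, a3, a4, a5, a6]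
  have c : (E * (A * E)).trace = (E * E * A).trace := by
    rw [← Matrix.mul_assoc, Matrix.trace_mul_comm, Matrix.mul_assoc]
  simp only [mul_one, one_mul, Matrix.trace_one, Fintype.card_fin, ht, c, Matrix.mul_assoc]
  ring

lemma hk_sq {n : ℕ} (M : Matrix (Fin n) (Fin n) ℝ) (h : M.transpose = M) :
    (M * M).trace = ∑ i, ∑ j, M i j ^ 2 := by
  simp only [Matrix.trace, Matrix.diag, Matrix.mul_apply]
  refine sum_congr rfl fun i _ => sum_congr rfl fun j _ => ?_
  have := congrFun (congrFun h i) j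
  rw [Matrix.transpose_apply] at this
  rw [this]; ring

lemma hk_quartic {n : ℕ} (hn : 3 ≤ n) (E : Matrix (Fin n) (Fin n) ℝ) (hE : E.transpose = E) :
    (E * E).trace ^ 2 / n ≤ (E * E * (E * E)).trace := by
  have hn0 : (n : ℝ) ≠ 0 := by positivity
  set q := (E * E).trace with hq
  have h := hk_sq (E * E - (q / n) • (1 : Matrix (Fin n) (Fin n) ℝ)) (by simp [hE])
  have h0 : 0 ≤ ∑ i, ∑ j, (E * E - (q / n) • (1 : Matrix (Fin n) (Fin n) ℝ)) i j ^ 2 := by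
    positivity
  rw [← h] at h0
  simp only [sub_mul, mul_sub, smul_mul_assoc, mul_smul_comm, mul_one, one_mul, Matrix.trace_sub,
    Matrix.trace_smul, Matrix.trace_one, Fintype.card_fin, smul_eq_mul, ← hq] at h0
  have : q / n * (q / n * n) = q ^ 2 / n := by field_simp
  have h2 : q / n * q = q ^ 2 / n := by ring
  linarith

lemma hk_bound {n : ℕ} (hn : 3 ≤ n) (E : Matrix (Fin n) (Fin n) ℝ) (hE : E.transpose = E)
    (ht : E.trace = 0) :
    ∃ A : Matrix (Fin n) (Fin n) ℝ,
    ∑ i, ∑ j, ∑ k, ∑ l, (hkK E E i j k l - hkK A 1 i j k l - hkK 1 A i j k l) ^ 2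
      ≤ 2 * ((n : ℝ) - 2) / (n - 1) * (E * E).trace ^ 2 := by
  have hn' : (3 : ℝ) ≤ n := by exact_mod_cast hn
  have h2 : (0 : ℝ) < n - 2 := by linarith
  have h1 : (0 : ℝ) < n - 1 := by linarith
  have h0 : (0 : ℝ) < n := by linarith
  have hf := hk_quartic hn E hE
  obtain ⟨q, hq⟩ : ∃ q, (E * E).trace = q := ⟨_, rfl⟩
  obtain ⟨f, hff⟩ : ∃ f, (E * E * (E * E)).trace = f := ⟨_, rfl⟩
  obtain ⟨a, ha⟩ : ∃ a : ℝ, a = 1 / ((n : ℝ) - 2) := ⟨_, rfl⟩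
  obtain ⟨c, hc⟩ : ∃ c : ℝ, c = q / (2 * ((n : ℝ) - 1) * (n - 2)) := ⟨_, rfl⟩
  refine ⟨c • 1 - a • (E * E), ?_⟩
  rw [hk_norm E _ hE (by simp [hE]) ht]
  simp only [sub_mul, mul_sub, smul_mul_assoc, mul_smul_comm, mul_one, one_mul, Matrix.trace_sub,
    Matrix.trace_smul, Matrix.trace_one, Fintype.card_fin, smul_eq_mul, hq, hff] at hf ⊢
  have key : 2 * ((n : ℝ) - 2) / (n - 1) * q ^ 2 - (2 * q ^ 2 - 2 * f + 4 * (n - 2) *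
      (c * (c * n) - a * (c * q) - (c * (a * q) - a * (a * f)))
      + 8 * (c * q - a * f) + 4 * (c * n - a * q) ^ 2)
      = 2 * n / (n - 2) * (f - q ^ 2 / n) := by
    rw [ha, hc]
    field_simp
    ring
  have : 0 ≤ 2 * (n : ℝ) / (n - 2) * (f - q ^ 2 / n) :=
    mul_nonneg (by positivity) (by linarith)
  have e7 : (2 * (n : ℝ) - 2 * 2) / (n - 1) * q ^ 2 = 2 * ((n : ℝ) - 2) / (n - 1) * q ^ 2 := by
    ring
  rw [e7]
  nlinarith [key, this]

lemma hk_cs {n : ℕ} (f g : Fin n → Fin n → Fin n → Fin n → ℝ) :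
    (∑ i, ∑ j, ∑ k, ∑ l, f i j k l * g i j k l) ^ 2 ≤
    (∑ i, ∑ j, ∑ k, ∑ l, f i j k l ^ 2) * (∑ i, ∑ j, ∑ k, ∑ l, g i j k l ^ 2) := by
  have := Finset.sum_mul_sq_le_sq_mul_sq (univ : Finset (Fin n × Fin n × Fin n × Fin n))
    (fun x => f x.1 x.2.1 x.2.2.1 x.2.2.2) (fun x => g x.1 x.2.1 x.2.2.1 x.2.2.2)
  simpa only [Fintype.sum_prod_type] using this

/-- Huisken's inequality: if `W` is a Weyl-type tensor (antisymmetric in the first and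
last pairs, pair-symmetric, first Bianchi, totally trace-free) and `E` is a real
symmetric trace-free matrix, then
`|∑ W_{ikjl} E_{ij} E_{kl}| ≤ √((n-2)/(2(n-1))) ‖W‖ ‖E‖²`. -/
theorem huisken_inequality (n : ℕ) (hn : 3 ≤ n)
    (W : Fin n → Fin n → Fin n → Fin n → ℝ)
    (hW1 : ∀ i j k l, W i j k l = -W j i k l)
    (hW2 : ∀ i j k l, W i j k l = -W i j l k)
    (hW3 : ∀ i j k l, W i j k l = W k l i j)
    (hW4 : ∀ i j k l, W i j k l + W i k l j + W i l j k = 0)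
    (hW5 : ∀ j l, ∑ i, W i j i l = 0)
    (E : Matrix (Fin n) (Fin n) ℝ)
    (hsymm : ∀ i j, E i j = E j i) (htrace : ∑ i, E i i = 0) :
    |∑ i, ∑ j, ∑ k, ∑ l, W i k j l * E i j * E k l| ≤
      Real.sqrt (((n : ℝ) - 2) / (2 * ((n : ℝ) - 1))) *
        Real.sqrt (∑ i, ∑ j, ∑ k, ∑ l, (W i j k l) ^ 2) *
        (∑ i, ∑ j, (E i j) ^ 2) := by
  have hE : E.transpose = E := by ext i j; exact hsymm j i
  have ht : E.trace = 0 := htrace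
  obtain ⟨A, hA⟩ := hk_bound hn E hE ht
  have hn' : (3 : ℝ) ≤ n := by exact_mod_cast hn
  -- the inner product with an antisymmetrized product
  have hWK : ∀ B C : Matrix (Fin n) (Fin n) ℝ,
      ∑ i, ∑ j, ∑ k, ∑ l, W i k j l * hkK B C i j k l
        = 2 * ∑ i, ∑ j, ∑ k, ∑ l, W i k j l * B i j * C k l := by
    intro B C
    have e := hk_swap (fun i j k l => W i k j l * B i j * C k l)
    have : ∀ i j k l, W i k j l * hkK B C i j k l =
        W i k j l * B i j * C k l + W i k l j * B i l * C k j := by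
      intro i j k l
      rw [hW2 i k l j]; simp only [hkK]; ring
    simp only [this, sum_add_distrib]
    rw [e]; ring
  have hT : ∀ i j, ∑ k, W i k j k = 0 := by
    intro i j
    rw [← hW5 i j]
    refine sum_congr rfl fun k _ => ?_
    rw [hW1, hW2]; ring
  have hWA : ∑ i, ∑ j, ∑ k, ∑ l, W i k j l * A i j * (1 : Matrix (Fin n) (Fin n) ℝ) k l = 0 := by
    refine sum_eq_zero fun i _ => sum_eq_zero fun j _ => ?_
    simp only [Matrix.one_apply, mul_ite, mul_one, mul_zero, sum_ite_eq, mem_univ, if_true]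
    rw [← Finset.sum_mul, hT, zero_mul]
  have hWA' : ∑ i, ∑ j, ∑ k, ∑ l, W i k j l * (1 : Matrix (Fin n) (Fin n) ℝ) i j * A k l = 0 := by
    have : ∀ i, ∑ j, ∑ k, ∑ l, W i k j l * (1 : Matrix (Fin n) (Fin n) ℝ) i j * A k l
        = ∑ k, ∑ l, W i k i l * A k l := by
      intro i
      rw [Finset.sum_eq_single i]
      · simp
      · intro j _ hj
        simp [Matrix.one_apply_ne hj.symm]
      · simp
    simp only [this]
    rw [sum_comm]
    refine sum_eq_zero fun k _ => ?_
    rw [sum_comm]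
    refine sum_eq_zero fun l _ => ?_
    rw [← Finset.sum_mul, hW5, zero_mul]
  have hcs := hk_cs (fun i j k l => W i k j l)
    (fun i j k l => hkK E E i j k l - hkK A 1 i j k l - hkK 1 A i j k l)
  have hWn : ∑ i, ∑ j, ∑ k, ∑ l, W i k j l ^ 2 = ∑ i, ∑ j, ∑ k, ∑ l, W i j k l ^ 2 :=
    sum_congr rfl fun i _ => sum_comm
  simp only [mul_sub, sum_sub_distrib, hWK, hWA, hWA', hWn] at hcs
  rw [hk_sq E hE] at hA
  set S := ∑ i, ∑ j, ∑ k, ∑ l, W i k j l * E i j * E k l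
  set N := ∑ i, ∑ j, ∑ k, ∑ l, W i j k l ^ 2
  set q := ∑ i, ∑ j, E i j ^ 2
  have hN : 0 ≤ N := sum_nonneg fun i _ => sum_nonneg fun j _ => sum_nonneg fun k _ =>
    sum_nonneg fun l _ => sq_nonneg _
  have hq : 0 ≤ q := sum_nonneg fun i _ => sum_nonneg fun j _ => sq_nonneg _
  clear_value S N q
  have hc : 0 ≤ ((n : ℝ) - 2) / (2 * ((n : ℝ) - 1)) :=
    div_nonneg (by linarith) (by linarith)
  refine abs_le_of_sq_le_sq ?_ (by positivity)
  rw [mul_pow, mul_pow, Real.sq_sqrt hc, Real.sq_sqrt hN]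
  have h5 := hcs.trans (mul_le_mul_of_nonneg_left hA hN)
  have h6 : 2 * ((n : ℝ) - 2) / (n - 1) = 4 * (((n : ℝ) - 2) / (2 * ((n : ℝ) - 1))) := by
    have : (n : ℝ) - 1 ≠ 0 := by linarith
    field_simp
    ring
  rw [h6] at h5
  nlinarith [h5]
end

section
/- Let n ≥ 3 and let Rm be an algebraic curvature tensor on ℝⁿ with Ricci tensor Ric, scalar curvature R, traceless Ricci tensor E, and Weyl tensor W. Then for all indices i, j: ∑_{k,p,q} Rm_{ikpq} Rm_{jkpq} = ∑_{k,p,q} W_{ikpq} W_{jkpq} + (4/(n−2))·∑_{k,l} W_{ikjl} E_{kl} + (2(n−4)/(n−2)²)·∑_k E_{ik} E_{jk} + (2/(n−2)²)·‖E‖²·δ_{ij} + (2/(n²(n−1)))·R²·δ_{ij} + (4/(n(n−1)))·R·E_{ij}, where ‖E‖² = ∑_{k,l} E_{kl}². -/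
open Finset

/-- Kronecker delta on `Fin n`. -/
def kron {n : ℕ} (i j : Fin n) : ℝ := if i = j then 1 else 0

lemma kron_comm' {n : ℕ} (i j : Fin n) : kron i j = kron j i := by
  unfold kron; simp only [eq_comm]

lemma sum_mul_kron {n : ℕ} (f : Fin n → ℝ) (a : Fin n) : ∑ q, f q * kron a q = f a := by
  simp [kron]

lemma sum_mul_kron' {n : ℕ} (f : Fin n → ℝ) (a : Fin n) : ∑ q, f q * kron q a = f a := by
  simp [kron]

lemma sum_kron_self {n : ℕ} : ∑ q : Fin n, kron q q = (n : ℝ) := by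
  simp [kron]

lemma contract_A {n : ℕ} (T : Fin n → Fin n → Fin n → ℝ) (E : Fin n → Fin n → ℝ) (j : Fin n) :
    ∑ k, ∑ p, ∑ q, T k p q *
      (E j p * kron k q - E j q * kron k p + E k q * kron j p - E k p * kron j q) =
    (∑ p, (∑ k, T k p k) * E j p) - (∑ p, (∑ k, T k k p) * E j p)
      + (∑ k, ∑ q, T k j q * E k q) - ∑ k, ∑ p, T k p j * E k p := by
  have e1 : ∑ p, (∑ k, T k p k) * E j p = ∑ k, ∑ p, ∑ q, (T k p q * E j p) * kron k q := by
    simp only [sum_mul_kron, Finset.sum_mul]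
    exact Finset.sum_comm
  have e2 : ∑ p, (∑ k, T k k p) * E j p = ∑ k, ∑ p, ∑ q, (T k p q * E j q) * kron k p := by
    have : ∀ k, ∑ p, ∑ q, (T k p q * E j q) * kron k p = ∑ q, T k k q * E j q := by
      intro k
      rw [Finset.sum_comm]
      refine Finset.sum_congr rfl fun q _ => ?_
      exact sum_mul_kron (fun p => T k p q * E j q) k
    simp only [this, Finset.sum_mul]
    exact Finset.sum_comm
  have e3 : ∑ k, ∑ q, T k j q * E k q = ∑ k, ∑ p, ∑ q, (T k p q * E k q) * kron j p := by
    refine Finset.sum_congr rfl fun k _ => ?_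
    rw [Finset.sum_comm]
    refine Finset.sum_congr rfl fun q _ => ?_
    exact (sum_mul_kron (fun p => T k p q * E k q) j).symm
  have e4 : ∑ k, ∑ p, T k p j * E k p = ∑ k, ∑ p, ∑ q, (T k p q * E k p) * kron j q := by
    simp only [sum_mul_kron]
  rw [e1, e2, e3, e4]
  simp only [← Finset.sum_sub_distrib, ← Finset.sum_add_distrib]
  refine Finset.sum_congr rfl fun k _ => Finset.sum_congr rfl fun p _ =>
    Finset.sum_congr rfl fun q _ => ?_
  ring

lemma contract_B {n : ℕ} (T : Fin n → Fin n → Fin n → ℝ) (j : Fin n) :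
    ∑ k, ∑ p, ∑ q, T k p q * (kron j p * kron k q - kron j q * kron k p) =
    (∑ k, T k j k) - ∑ k, T k k j := by
  have e1 : ∑ k, T k j k = ∑ k, ∑ p, ∑ q, (T k p q * kron j p) * kron k q := by
    simp only [sum_mul_kron]
  have e2 : ∑ k, T k k j = ∑ k, ∑ p, ∑ q, (T k p q * kron k p) * kron j q := by
    simp only [sum_mul_kron]
  rw [e1, e2]
  simp only [← Finset.sum_sub_distrib]
  refine Finset.sum_congr rfl fun k _ => Finset.sum_congr rfl fun p _ =>
    Finset.sum_congr rfl fun q _ => ?_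
  ring

/-- Identity (2-Sec-16): for an algebraic curvature tensor `Rm` with traceless Ricci
tensor `E`, scalar curvature `R` and Weyl tensor `W`,
`Rm_{ikpq} Rm_{jkpq} = W_{ikpq} W_{jkpq} + (4/(n-2)) W_{ikjl} E_{kl}
  + (2(n-4)/(n-2)²) E_{ik}E_{jk} + (2/(n-2)²)|E|² δ_{ij}
  + (2/(n²(n-1))) R² δ_{ij} + (4/(n(n-1))) R E_{ij}`. -/
theorem curvature_identity_2_16 (n : ℕ) (hn : 3 ≤ n)
    (Rm : Fin n → Fin n → Fin n → Fin n → ℝ)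
    (h1 : ∀ i j k l, Rm i j k l = -Rm j i k l)
    (h2 : ∀ i j k l, Rm i j k l = -Rm i j l k)
    (h3 : ∀ i j k l, Rm i j k l = Rm k l i j)
    (h4 : ∀ i j k l, Rm i j k l + Rm i k l j + Rm i l j k = 0)
    (Ric : Fin n → Fin n → ℝ) (hRic : ∀ i k, Ric i k = ∑ j, Rm i j k j)
    (R : ℝ) (hR : R = ∑ i, Ric i i)
    (E : Fin n → Fin n → ℝ)
    (hE : ∀ i j, E i j = Ric i j - (R / (n : ℝ)) * kron i j)
    (W : Fin n → Fin n → Fin n → Fin n → ℝ)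
    (hW : ∀ i j k l, W i j k l = Rm i j k l
      - (1 / ((n : ℝ) - 2)) *
        (E i k * kron j l - E i l * kron j k + E j l * kron i k - E j k * kron i l)
      - (R / ((n : ℝ) * ((n : ℝ) - 1))) * (kron i k * kron j l - kron i l * kron j k)) :
    ∀ i j, ∑ k, ∑ p, ∑ q, Rm i k p q * Rm j k p q =
      (∑ k, ∑ p, ∑ q, W i k p q * W j k p q)
      + (4 / ((n : ℝ) - 2)) * ∑ k, ∑ l, W i k j l * E k l
      + (2 * ((n : ℝ) - 4) / ((n : ℝ) - 2) ^ 2) * ∑ k, E i k * E j k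
      + (2 / ((n : ℝ) - 2) ^ 2) * (∑ k, ∑ l, (E k l) ^ 2) * kron i j
      + (2 / ((n : ℝ) ^ 2 * ((n : ℝ) - 1))) * R ^ 2 * kron i j
      + (4 / ((n : ℝ) * ((n : ℝ) - 1))) * R * E i j := by
  intro i j
  have hn3 : (3 : ℝ) ≤ n := by exact_mod_cast hn
  have hn0 : (n : ℝ) ≠ 0 := by linarith
  have hn1 : (n : ℝ) - 1 ≠ 0 := by intro h; linarith
  have hn2 : (n : ℝ) - 2 ≠ 0 := by intro h; linarith
  have hRs : ∀ a b, Ric a b = Ric b a := by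
    intro a b
    rw [hRic, hRic]
    exact Finset.sum_congr rfl fun k _ => h3 _ _ _ _
  have hEs : ∀ a b, E a b = E b a := by
    intro a b
    rw [hE, hE, hRs, kron_comm']
  have hEt : ∑ k, E k k = 0 := by
    simp only [hE, Finset.sum_sub_distrib, ← Finset.mul_sum, sum_kron_self, ← hR]
    field_simp
    ring
  have hRicE : ∀ a b, Ric a b = E a b + (R / (n : ℝ)) * kron a b := by
    intro a b; rw [hE]; ring
  have hRt : ∀ a b, ∑ k, Rm a k k b = - Ric a b := by
    intro a b
    rw [hRic, ← Finset.sum_neg_distrib]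
    exact Finset.sum_congr rfl fun k _ => h2 _ _ _ _
  have hW2 : ∀ a b c d, W a b c d = - W a b d c := by
    intro a b c d
    rw [hW, hW, h2]; ring
  have hW3 : ∀ a b c d, W a b c d = W c d a b := by
    intro a b c d
    rw [hW, hW, h3, hEs c a, hEs c b, hEs d b, hEs d a, kron_comm' c a, kron_comm' c b,
      kron_comm' d b, kron_comm' d a]
    ring
  have hWt : ∀ a b, ∑ k, W a k b k = 0 := by
    intro a b
    have e : ∀ k, W a k b k = Rm a k b k
        - (1 / ((n : ℝ) - 2)) * (E a b * kron k k - E a k * kron k b + E k k * kron a b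
            - E k b * kron a k)
        - (R / ((n : ℝ) * ((n : ℝ) - 1))) * (kron a b * kron k k - kron a k * kron k b) :=
      fun k => hW a k b k
    simp only [e, Finset.sum_sub_distrib, Finset.sum_add_distrib, ← Finset.mul_sum,
      ← Finset.sum_mul, sum_kron_self, sum_mul_kron, sum_mul_kron', hEt, ← hRic, hRicE]
    field_simp
    ring
  have hWt' : ∀ a b, ∑ k, W a k k b = 0 := by
    intro a b
    rw [← neg_eq_zero, ← Finset.sum_neg_distrib, ← hWt a b]
    exact Finset.sum_congr rfl fun k _ => (hW2 _ _ _ _).symm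
  set a : ℝ := 1 / ((n : ℝ) - 2) with ha
  set c : ℝ := R / ((n : ℝ) * ((n : ℝ) - 1)) with hc
  set S := ∑ k, ∑ l, W i k j l * E k l with hS
  set Q := ∑ k, E i k * E j k with hQ
  set N := ∑ k, ∑ l, (E k l) ^ 2 with hN
  have hA1 := contract_A (Rm j) E i
  have hB1 := contract_B (Rm j) i
  have hA2 := contract_A (W i) E j
  have hB2 := contract_B (W i) j
  have split : ∑ k, ∑ p, ∑ q, Rm i k p q * Rm j k p q =
      (∑ k, ∑ p, ∑ q, W i k p q * W j k p q)
      + a * (∑ k, ∑ p, ∑ q, Rm j k p q *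
          (E i p * kron k q - E i q * kron k p + E k q * kron i p - E k p * kron i q))
      + c * (∑ k, ∑ p, ∑ q, Rm j k p q * (kron i p * kron k q - kron i q * kron k p))
      + a * (∑ k, ∑ p, ∑ q, W i k p q *
          (E j p * kron k q - E j q * kron k p + E k q * kron j p - E k p * kron j q))
      + c * (∑ k, ∑ p, ∑ q, W i k p q * (kron j p * kron k q - kron j q * kron k p)) := by
    simp only [Finset.mul_sum, ← Finset.sum_add_distrib]
    refine Finset.sum_congr rfl fun k _ => Finset.sum_congr rfl fun p _ =>
      Finset.sum_congr rfl fun q _ => ?_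
    rw [hW i k p q, hW j k p q]
    ring
  have hWn : ∑ k, ∑ p, W i k p j * E k p = - S := by
    rw [hS, ← Finset.sum_neg_distrib]
    refine Finset.sum_congr rfl fun k _ => ?_
    rw [← Finset.sum_neg_distrib]
    refine Finset.sum_congr rfl fun p _ => ?_
    rw [hW2]; ring
  have hRn : ∑ k, ∑ p, Rm j k p i * E k p = - ∑ k, ∑ p, Rm j k i p * E k p := by
    rw [← Finset.sum_neg_distrib]
    refine Finset.sum_congr rfl fun k _ => ?_
    rw [← Finset.sum_neg_distrib]
    refine Finset.sum_congr rfl fun p _ => ?_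
    rw [h2]; ring
  have hS' : ∑ k, ∑ l, W j k i l * E k l = S := by
    rw [hS, Finset.sum_comm]
    refine Finset.sum_congr rfl fun k _ => Finset.sum_congr rfl fun p _ => ?_
    rw [hW3, hEs]
  have hRicSum : ∑ p, Ric j p * E i p = Q + R / n * E i j := by
    have e : ∀ p, Ric j p * E i p = E i p * E j p + R / n * (E i p * kron j p) := by
      intro p; rw [hRicE]; ring
    simp only [e, Finset.sum_add_distrib, ← Finset.mul_sum, sum_mul_kron, ← hQ]
  have hRE : ∑ k, ∑ p, Rm j k i p * E k p = S + a * (N * kron i j - 2 * Q) - c * E i j := by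
    have e : ∀ k p, Rm j k i p * E k p = W j k i p * E k p
        + a * (E j i * (E k p * kron k p) - E k i * (E j p * E k p) * 0
          - (E j p * E k p) * kron k i + E k p ^ 2 * kron j i - E k i * (E k p * kron j p))
        + c * (kron j i * (E k p * kron k p) - kron k i * (E k p * kron j p)) := by
      intro k p; rw [hW j k i p]; ring
    have e1 : ∑ k, ∑ p, (E j p * E k p) * kron k i = Q := by
      simp only [← Finset.sum_mul, sum_mul_kron']
      rw [hQ]
      exact Finset.sum_congr rfl fun p _ => mul_comm _ _
    have e2 : ∑ k, E k i * E k j = Q := by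
      rw [hQ]
      exact Finset.sum_congr rfl fun p _ => by rw [hEs p i, hEs p j]
    have e3 : ∑ k, kron k i * E k j = E i j := by
      simp only [mul_comm (kron _ i), sum_mul_kron']
    simp only [e, Finset.sum_add_distrib, Finset.sum_sub_distrib, ← Finset.mul_sum, mul_zero,
      Finset.sum_const_zero, sum_mul_kron, hEt, hS', e1, e2, e3]
    simp only [← Finset.sum_mul, ← hN, kron_comm' j i]
    ring
  simp only [hRt, hRn, hRE, ← hRic, neg_mul, Finset.sum_neg_distrib, hRicSum] at hA1 hB1
  simp only [hWt, hWt', hWn, zero_mul, Finset.sum_const_zero] at hA2 hB2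
  rw [← hS] at hA2
  rw [split, hA1, hB1, hA2, hB2, hRicE, kron_comm' j i, hEs j i, ha, hc]
  field_simp
  ring
end

section
/- Let n ≥ 3, let T : (Fin n)³ → ℝ be totally symmetric (invariant under all permutations of its three indices) and trace-free (∑_k T_{ikk} = 0 for all i), and let u be a real symmetric n×n matrix with trace zero and ∑_{j,k} u_{jk}² = 1. Then ∑_i (∑_{j,k} T_{ijk} u_{jk})² ≤ (n/(n+2)) · ∑_{i,j,k} T_{ijk}². -/
open Finset

/-- Kronecker delta. -/
def kd {n : ℕ} (i j : Fin n) : ℝ := if i = j then 1 else 0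

lemma kd_symm {n : ℕ} (i j : Fin n) : kd i j = kd j i := by
  simp [kd, eq_comm]

lemma sum_kd {n : ℕ} (f : Fin n → ℝ) (i : Fin n) : ∑ j, f j * kd i j = f i := by
  simp [kd]

/-- The symmetric trace-free projection of `v ⊗ u`, with `w = u v`. -/
noncomputable def projS {n : ℕ} (b : ℝ) (u : Fin n → Fin n → ℝ) (v w : Fin n → ℝ)
    (i j k : Fin n) : ℝ :=
  (v i * u j k + v j * u i k + v k * u i j) / 3
    - b * (w i * kd j k + w j * kd i k + w k * kd i j)

/-- pairing a symmetric tensor with cyclic permutes -/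
lemma pair_perm {n : ℕ} (R : Fin n → Fin n → Fin n → ℝ)
    (h1 : ∀ i j k, R i j k = R j i k) (h2 : ∀ i j k, R i j k = R i k j)
    (v : Fin n → ℝ) (u : Fin n → Fin n → ℝ) :
    (∑ i, ∑ j, ∑ k, R i j k * (v j * u i k) = ∑ i, ∑ j, ∑ k, R i j k * (v i * u j k)) ∧
    (∑ i, ∑ j, ∑ k, R i j k * (v k * u i j) = ∑ i, ∑ j, ∑ k, R i j k * (v i * u j k)) := by
  have A : ∑ i, ∑ j, ∑ k, R i j k * (v j * u i k)
      = ∑ i, ∑ j, ∑ k, R i j k * (v i * u j k) := by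
    rw [sum_comm]
    refine sum_congr rfl fun i _ => sum_congr rfl fun j _ => sum_congr rfl fun k _ => ?_
    rw [h1]
  refine ⟨A, ?_⟩
  rw [← A]
  refine sum_congr rfl fun i _ => ?_
  rw [sum_comm]
  refine sum_congr rfl fun j _ => sum_congr rfl fun k _ => ?_
  rw [h2]

lemma pair_kd {n : ℕ} (R : Fin n → Fin n → Fin n → ℝ) (ht : ∀ i, ∑ k, R i k k = 0)
    (w : Fin n → ℝ) : ∑ i, ∑ j, ∑ k, R i j k * (w i * kd j k) = 0 := by
  refine sum_eq_zero fun i _ => ?_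
  have : ∀ j, ∑ k, R i j k * (w i * kd j k) = w i * R i j j := by
    intro j
    rw [← sum_kd (fun k => w i * R i j k) j]
    exact sum_congr rfl fun k _ => by ring
  simp_rw [this, ← mul_sum, ht, mul_zero]

lemma pair_S {n : ℕ} (R : Fin n → Fin n → Fin n → ℝ)
    (h1 : ∀ i j k, R i j k = R j i k) (h2 : ∀ i j k, R i j k = R i k j)
    (ht : ∀ i, ∑ k, R i k k = 0) (b : ℝ) (u : Fin n → Fin n → ℝ) (v w : Fin n → ℝ) :
    ∑ i, ∑ j, ∑ k, R i j k * projS b u v w i j k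
      = ∑ i, ∑ j, ∑ k, R i j k * (v i * u j k) := by
  obtain ⟨a1, a2⟩ := pair_perm R h1 h2 v u
  obtain ⟨b1, b2⟩ := pair_perm R h1 h2 w kd
  have b0 := pair_kd R ht w
  have : ∑ i, ∑ j, ∑ k, R i j k * projS b u v w i j k =
      ((∑ i, ∑ j, ∑ k, R i j k * (v i * u j k)) + (∑ i, ∑ j, ∑ k, R i j k * (v j * u i k))
        + ∑ i, ∑ j, ∑ k, R i j k * (v k * u i j)) / 3
      - b * ((∑ i, ∑ j, ∑ k, R i j k * (w i * kd j k))
        + (∑ i, ∑ j, ∑ k, R i j k * (w j * kd i k))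
        + ∑ i, ∑ j, ∑ k, R i j k * (w k * kd i j)) := by
    simp only [← sum_add_distrib, sum_div, mul_sum, ← sum_sub_distrib]
    refine sum_congr rfl fun i _ => sum_congr rfl fun j _ => sum_congr rfl fun k _ => ?_
    unfold projS
    ring
  rw [this, a1, a2, b1, b2, b0]
  ring

/-- `|u v|² ≤ (n-1)/n |v|²` for unit trace-free symmetric `u`. -/
lemma op_bound {n : ℕ} (hn : 3 ≤ n) (u : Fin n → Fin n → ℝ)
    (husym : ∀ i j, u i j = u j i) (hutr : ∑ i, u i i = 0)
    (hunorm : ∑ j, ∑ k, (u j k) ^ 2 = 1) (v w : Fin n → ℝ)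
    (hw : ∀ i, w i = ∑ j, u i j * v j) :
    n * ∑ i, w i ^ 2 ≤ (n - 1) * ∑ i, v i ^ 2 := by
  have hn' : (3 : ℝ) ≤ n := by exact_mod_cast hn
  set W := ∑ i, w i ^ 2 with hW
  set V := ∑ i, v i ^ 2 with hV
  set p := ∑ i, w i * v i with hp
  have hW0 : 0 ≤ W := sum_nonneg fun i _ => sq_nonneg _
  have hV0 : 0 ≤ V := sum_nonneg fun i _ => sq_nonneg _
  have hp2 : p ^ 2 ≤ W * V := sum_mul_sq_le_sq_mul_sq _ _ _
  have e1 : ∑ i, ∑ j, u i j * (w i * v j) = W := by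
    rw [hW]
    refine sum_congr rfl fun i _ => ?_
    rw [pow_two]
    nth_rewrite 3 [hw i]
    rw [mul_sum]
    exact sum_congr rfl fun j _ => by ring
  have e2 : ∑ i, ∑ j, u i j * (w j * v i) = W := by
    rw [← e1, sum_comm]
    exact sum_congr rfl fun i _ => sum_congr rfl fun j _ => by rw [husym]
  have e3 : ∑ i, ∑ j, u i j * kd i j = 0 := by
    rw [← hutr]
    exact sum_congr rfl fun i _ => sum_kd (fun j => u i j) i
  have f1 : ∑ i, ∑ j, w i ^ 2 * v j ^ 2 = W * V := by
    rw [hW, hV, sum_mul_sum]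
  have f2 : ∑ i, ∑ j, w j ^ 2 * v i ^ 2 = W * V := by
    rw [← f1, sum_comm]
  have f3 : ∑ i, ∑ j, (w i * v i) * (w j * v j) = p ^ 2 := by
    rw [pow_two, hp, sum_mul_sum]
  have f4 : ∑ i, ∑ j, (w i * v j) * kd i j = p :=
    sum_congr rfl fun i _ => sum_kd (fun j => w i * v j) i
  have f5 : ∑ i, ∑ j, (w j * v i) * kd i j = p :=
    sum_congr rfl fun i _ => sum_kd (fun j => w j * v i) i
  have f6 : ∑ i : Fin n, ∑ j, kd i j * kd i j = n := by
    have : ∀ i : Fin n, ∑ j, kd i j * kd i j = 1 := fun i => by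
      rw [sum_kd (fun j => kd i j) i]; simp [kd]
    simp [this]
  -- square expansion
  have key : ∀ t q : ℝ, 0 ≤ 1 - 2 * t * W + t ^ 2 * ((W * V + p ^ 2) / 2)
      - 2 * t * q * p * t + q ^ 2 * t ^ 2 * n := by
    intro t q
    have h0 : 0 ≤ ∑ i, ∑ j, (u i j - t * ((w i * v j + w j * v i) / 2 - q * kd i j)) ^ 2 :=
      sum_nonneg fun i _ => sum_nonneg fun j _ => sq_nonneg _
    have : ∑ i, ∑ j, (u i j - t * ((w i * v j + w j * v i) / 2 - q * kd i j)) ^ 2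
       = (∑ j, ∑ k, (u j k) ^ 2) - t * (∑ i, ∑ j, u i j * (w i * v j))
         - t * (∑ i, ∑ j, u i j * (w j * v i)) + 2 * t * q * (∑ i, ∑ j, u i j * kd i j)
         + t ^ 2 / 4 * (∑ i, ∑ j, w i ^ 2 * v j ^ 2) + t ^ 2 / 4 * (∑ i, ∑ j, w j ^ 2 * v i ^ 2)
         + t ^ 2 / 2 * (∑ i, ∑ j, (w i * v i) * (w j * v j))
         - t ^ 2 * q * (∑ i, ∑ j, (w i * v j) * kd i j)
         - t ^ 2 * q * (∑ i, ∑ j, (w j * v i) * kd i j)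
         + t ^ 2 * q ^ 2 * (∑ i : Fin n, ∑ j, kd i j * kd i j) := by
      simp only [← sum_add_distrib, mul_sum, ← sum_sub_distrib]
      refine sum_congr rfl fun i _ => sum_congr rfl fun j _ => ?_
      ring
    rw [this, hunorm, e1, e2, e3, f1, f2, f3, f4, f5, f6] at h0
    linarith
  have hn0 : (n : ℝ) ≠ 0 := by positivity
  by_contra hcon
  push Not at hcon
  have hWpos : 0 < W := by nlinarith
  -- choose t = 1 / W, q = p / n
  have k := key (1 / W) (p / n)
  have k2 : 0 ≤ n * (-W ^ 2 + (W * V + p ^ 2) / 2) - p ^ 2 := by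
    have := mul_nonneg (mul_nonneg k (sq_nonneg W)) (Nat.cast_nonneg (α := ℝ) n)
    have e : (1 - 2 * (1 / W) * W + (1 / W) ^ 2 * ((W * V + p ^ 2) / 2)
      - 2 * (1 / W) * (p / n) * p * (1 / W) + (p / n) ^ 2 * (1 / W) ^ 2 * n) * W ^ 2 * n
      = n * (-W ^ 2 + (W * V + p ^ 2) / 2) - p ^ 2 := by
      field_simp
      ring
    linarith
  have : (n / 2 - 1) * p ^ 2 ≤ (n / 2 - 1) * (W * V) :=
    mul_le_mul_of_nonneg_left hp2 (by linarith)
  have : W * ((n - 1) * V) < W * (n * W) := mul_lt_mul_of_pos_left hcon hWpos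
  nlinarith


/-- Pointwise algebraic content of Bourguignon's refined Kato inequality: if `T` is a
totally symmetric trace-free 3-tensor and `u` is a unit-norm symmetric trace-free
matrix, then `∑_i (∑_{jk} T_{ijk} u_{jk})² ≤ (n/(n+2)) ∑ T_{ijk}²`. -/
theorem kato_algebraic (n : ℕ) (hn : 3 ≤ n)
    (T : Fin n → Fin n → Fin n → ℝ)
    (hsym1 : ∀ i j k, T i j k = T j i k)
    (hsym2 : ∀ i j k, T i j k = T i k j)
    (htf : ∀ i, ∑ k, T i k k = 0)
    (u : Matrix (Fin n) (Fin n) ℝ)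
    (husym : ∀ i j, u i j = u j i)
    (hutr : ∑ i, u i i = 0)
    (hunorm : ∑ j, ∑ k, (u j k) ^ 2 = 1) :
    ∑ i, (∑ j, ∑ k, T i j k * u j k) ^ 2 ≤
      ((n : ℝ) / ((n : ℝ) + 2)) * ∑ i, ∑ j, ∑ k, (T i j k) ^ 2 := by
  have hn' : (3 : ℝ) ≤ n := by exact_mod_cast hn
  have hn2 : (n : ℝ) + 2 ≠ 0 := by positivity
  have hn0 : (n : ℝ) ≠ 0 := by positivity
  set v : Fin n → ℝ := fun i => ∑ j, ∑ k, T i j k * u j k with hv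
  set w : Fin n → ℝ := fun i => ∑ j, u i j * v j with hw
  have hop := op_bound hn u husym hutr hunorm v w (fun i => rfl)
  set b : ℝ := 2 / (3 * (n + 2)) with hb
  set S := projS b u v w with hS
  have S1 : ∀ i j k, S i j k = S j i k := by
    intro i j k
    simp only [hS, projS]
    rw [husym i j, kd_symm i j]
    ring
  have S2 : ∀ i j k, S i j k = S i k j := by
    intro i j k
    simp only [hS, projS]
    rw [husym j k, kd_symm j k]
    ring
  have hwk : ∀ i, ∑ k, w k * kd i k = w i := fun i => sum_kd w i
  have hkk : ∑ k : Fin n, kd k k = n := by simp [kd]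
  have St : ∀ i, ∑ k, S i k k = 0 := by
    intro i
    have : ∑ k, S i k k = (v i * (∑ k, u k k) + 2 * ∑ k, u i k * v k) / 3
        - b * (w i * (∑ k : Fin n, kd k k) + 2 * ∑ k, w k * kd i k) := by
      simp only [← sum_add_distrib, mul_sum, sum_div, ← sum_sub_distrib]
      refine sum_congr rfl fun k _ => ?_
      simp only [hS, projS]
      ring
    rw [this, hutr, hwk, hkk, hb]
    change (v i * 0 + 2 * w i) / 3 - _ = 0
    field_simp
    ring
  have TS := pair_S T hsym1 hsym2 htf b u v w
  have SS := pair_S S S1 S2 St b u v w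
  have TV : ∑ i, ∑ j, ∑ k, T i j k * (v i * u j k) = ∑ i, v i ^ 2 := by
    refine sum_congr rfl fun i _ => ?_
    rw [pow_two]
    nth_rewrite 3 [hv]
    simp only [mul_sum]
    exact sum_congr rfl fun j _ => sum_congr rfl fun k _ => by ring
  have hwv : ∀ i, ∑ k, u i k * v k = w i := fun i => rfl
  have g2 : ∑ i, ∑ j, ∑ k, (v j * u i k) * (v i * u j k) = ∑ i, w i ^ 2 := by
    have : ∀ k, w k ^ 2 = ∑ i, ∑ j, (v j * u i k) * (v i * u j k) := by
      intro k
      rw [pow_two, ← hwv, sum_mul_sum]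
      refine sum_congr rfl fun i _ => sum_congr rfl fun j _ => ?_
      rw [husym k i, husym k j]; ring
    simp_rw [this]
    rw [sum_comm]
    rw [sum_comm]
    conv_rhs => rw [sum_comm]
    exact sum_congr rfl fun i _ => by rw [sum_comm]
  have g1 : ∑ i, ∑ j, ∑ k, (v i * u j k) * (v i * u j k) = ∑ i, v i ^ 2 := by
    refine sum_congr rfl fun i _ => ?_
    rw [← mul_one (v i ^ 2), ← hunorm]
    simp only [mul_sum]
    exact sum_congr rfl fun j _ => sum_congr rfl fun k _ => by ring
  have g3 : ∑ i, ∑ j, ∑ k, (v k * u i j) * (v i * u j k) = ∑ i, w i ^ 2 := by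
    rw [← g2]
    refine sum_congr rfl fun i _ => ?_
    rw [sum_comm]
    refine sum_congr rfl fun j _ => sum_congr rfl fun k _ => ?_
    rw [husym j k]
  have g4 : ∑ i, ∑ j, ∑ k, (w i * kd j k) * (v i * u j k) = 0 := by
    refine sum_eq_zero fun i _ => ?_
    have : ∀ j, ∑ k, (w i * kd j k) * (v i * u j k) = w i * v i * u j j := by
      intro j
      rw [← sum_kd (fun k => w i * v i * u j k) j]
      exact sum_congr rfl fun k _ => by ring
    simp_rw [this, ← mul_sum, hutr, mul_zero]
  have g5 : ∑ i, ∑ j, ∑ k, (w j * kd i k) * (v i * u j k) = ∑ i, w i ^ 2 := by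
    rw [sum_comm]
    refine sum_congr rfl fun j _ => ?_
    rw [pow_two]
    nth_rewrite 3 [← hwv j]
    rw [mul_sum]
    refine sum_congr rfl fun i _ => ?_
    rw [← sum_kd (fun k => w j * (u j k * v i)) i]
    exact sum_congr rfl fun k _ => by ring
  have g6 : ∑ i, ∑ j, ∑ k, (w k * kd i j) * (v i * u j k) = ∑ i, w i ^ 2 := by
    rw [← g5]
    refine sum_congr rfl fun i _ => ?_
    rw [sum_comm]
    refine sum_congr rfl fun j _ => sum_congr rfl fun k _ => ?_
    rw [husym j k]
  have SV : ∑ i, ∑ j, ∑ k, S i j k * (v i * u j k)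
      = ((∑ i, v i ^ 2) + 2 * ∑ i, w i ^ 2) / 3 - b * (2 * ∑ i, w i ^ 2) := by
    have : ∑ i, ∑ j, ∑ k, S i j k * (v i * u j k)
      = ((∑ i, ∑ j, ∑ k, (v i * u j k) * (v i * u j k))
          + (∑ i, ∑ j, ∑ k, (v j * u i k) * (v i * u j k))
          + ∑ i, ∑ j, ∑ k, (v k * u i j) * (v i * u j k)) / 3
        - b * ((∑ i, ∑ j, ∑ k, (w i * kd j k) * (v i * u j k))
          + (∑ i, ∑ j, ∑ k, (w j * kd i k) * (v i * u j k))
          + ∑ i, ∑ j, ∑ k, (w k * kd i j) * (v i * u j k)) := by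
      simp only [← sum_add_distrib, sum_div, mul_sum, ← sum_sub_distrib]
      refine sum_congr rfl fun i _ => sum_congr rfl fun j _ => sum_congr rfl fun k _ => ?_
      simp only [hS, projS]
      ring
    rw [this, g1, g2, g3, g4, g5, g6]
    ring
  rw [TV] at TS
  rw [SV] at SS
  change ∑ i, v i ^ 2 ≤ _
  set V := ∑ i, v i ^ 2
  set W := ∑ i, w i ^ 2
  set N := ∑ i, ∑ j, ∑ k, (T i j k) ^ 2 with hN
  set c : ℝ := (n + 2) / n with hc
  have hc0 : 0 < c := by positivity
  have hexp : 0 ≤ N - 2 * c * V + c ^ 2 * ((V + 2 * W) / 3 - b * (2 * W)) := by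
    have h0 : 0 ≤ ∑ i, ∑ j, ∑ k, (T i j k - c * S i j k) ^ 2 :=
      sum_nonneg fun i _ => sum_nonneg fun j _ => sum_nonneg fun k _ => sq_nonneg _
    have : ∑ i, ∑ j, ∑ k, (T i j k - c * S i j k) ^ 2 = N
        - 2 * c * (∑ i, ∑ j, ∑ k, T i j k * S i j k)
        + c ^ 2 * (∑ i, ∑ j, ∑ k, S i j k * S i j k) := by
      simp only [hN, ← sum_add_distrib, mul_sum, ← sum_sub_distrib]
      refine sum_congr rfl fun i _ => sum_congr rfl fun j _ => sum_congr rfl fun k _ => ?_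
      ring
    rw [this, TS, SS] at h0
    exact h0
  have hSb : c * ((V + 2 * W) / 3 - b * (2 * W)) ≤ V := by
    have : c * ((V + 2 * W) / 3 - b * (2 * W)) = ((n + 2) * V + 2 * (n * W)) / (3 * n) := by
      rw [hc, hb]
      field_simp
      ring
    rw [this, div_le_iff₀ (by positivity)]
    linarith
  have h3 : c * V ≤ N := by nlinarith [mul_le_mul_of_nonneg_left hSb hc0.le]
  have h4 : (n : ℝ) / (n + 2) * (c * V) = V := by
    rw [hc]; field_simp
  rw [← h4]
  exact mul_le_mul_of_nonneg_left h3 (by positivity)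
end
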